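/- Assume p01 ≤ p11 and β ∈ [0,1]. Then for every t ∈ {1,…,T}, every increasingly ordered vector 0 ≤ ω_1 ≤ ω_2 ≤ ⋯ ≤ ω_n ≤ 1, every index j with 0 ≤ j ≤ n−2, and all x, y ∈ [0,1] with x ≥ y, the adjacent-swap inequality holds: W_t(ω_1, …, ω_j, y, x, ω_{j+3}, …, ω_n) ≥ W_t(ω_1, …, ω_j, x, y, ω_{j+3}, …, ω_n), where y and x (respectively x and y) occupy positions j+1 and j+2; the case j = 0 reads W_t(y, x, ω_3, …, ω_n) ≥ W_t(x, y, ω_3, …, ω_n). -/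

import Mathlib

open Finset

noncomputable section

/-- The one-step belief update for an unobserved channel. -/
def tauF (p01 p11 : ℝ) (w : ℝ) : ℝ := w * p11 + (1 - w) * p01

/-- The set of admissible actions: subsets of `Fin n` of cardinality `k`. -/
def actions (n k : ℕ) : Finset (Finset (Fin n)) :=
  (Finset.univ : Finset (Fin n)).powersetCard k

lemma actions_nonempty {n k : ℕ} (hk : k ≤ n) : (actions n k).Nonempty := by
  rw [actions, Finset.powersetCard_nonempty, Finset.card_univ, Fintype.card_fin]
  exact hk

/-- Number of `true` entries in a `{0,1}^k` realization. -/
def countTrue {k : ℕ} (l : Fin k → Bool) : ℕ :=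
  (Finset.univ.filter fun i => l i = true).card

/-- `q(l; u) = ∏ u_i^{l_i} (1-u_i)^{1-l_i}`. -/
def qProb {k : ℕ} (u : Fin k → ℝ) (l : Fin k → Bool) : ℝ :=
  ∏ i : Fin k, if l i then u i else 1 - u i

/-- The top `k` coordinates `(ω_{n-k+1}, …, ω_n)` of a length-`n` vector. -/
def topCoords {n k : ℕ} (hk : k ≤ n) (ω : Fin n → ℝ) : Fin k → ℝ :=
  fun i => ω ⟨n - k + i.val, by omega⟩

/-- The vector `v_l`: `k - m` copies of `p01`, then `τ(ω_1),…,τ(ω_{n-k})`,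
then `m` copies of `p11`, where `m` is the number of ones in `l`. -/
def vl {n : ℕ} (k : ℕ) (p01 p11 : ℝ) (ω : Fin n → ℝ) (m : ℕ) : Fin n → ℝ :=
  fun j =>
    if j.val < k - m then p01
    else if j.val < n - m then tauF p01 p11 (ω ⟨j.val - (k - m), by omega⟩)
    else p11

/-- The greedy-policy value functions `W`, indexed by the number of remaining
steps (`r = 0` corresponds to the terminal time `T`). -/
def Wval (n k : ℕ) (hk : k ≤ n) (p01 p11 β : ℝ) : ℕ → (Fin n → ℝ) → ℝ
  | 0, ω => ∑ i : Fin n, if n - k ≤ i.val then ω i else 0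
  | r + 1, ω =>
      (∑ i : Fin n, if n - k ≤ i.val then ω i else 0) +
        β * ∑ l : Fin k → Bool,
          qProb (topCoords hk ω) l *
            Wval n k hk p01 p11 β r (vl k p01 p11 ω (countTrue l))

/-- The updated information state `ω^{a,s}`. -/
def nextState {n : ℕ} (p01 p11 : ℝ) (ω : Fin n → ℝ) (a : Finset (Fin n))
    (s : {i // i ∈ a} → Bool) : Fin n → ℝ :=
  fun j => if h : j ∈ a then (if s ⟨j, h⟩ then p11 else p01) else tauF p01 p11 (ω j)

/-- The probability of the realization `s` of the selected channels `a`. -/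
def obsProb {n : ℕ} (ω : Fin n → ℝ) (a : Finset (Fin n))
    (s : {i // i ∈ a} → Bool) : ℝ :=
  ∏ i : {i // i ∈ a}, if s i then ω i.val else 1 - ω i.val

/-- The optimal value functions `V`, indexed by the number of remaining steps. -/
def Vval (n k : ℕ) (hk : k ≤ n) (p01 p11 β : ℝ) : ℕ → (Fin n → ℝ) → ℝ
  | 0, ω => (actions n k).sup' (actions_nonempty hk) fun a => ∑ i ∈ a, ω i
  | r + 1, ω =>
      (actions n k).sup' (actions_nonempty hk) fun a =>
        (∑ i ∈ a, ω i) +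
          β * ∑ s : {i // i ∈ a} → Bool,
            obsProb ω a s * Vval n k hk p01 p11 β r (nextState p01 p11 ω a s)

/-- `Q_t(ω, a)`: the value of taking action `a` now and acting optimally
afterwards, indexed by the number of remaining steps. -/
def Qval (n k : ℕ) (hk : k ≤ n) (p01 p11 β : ℝ) : ℕ → (Fin n → ℝ) → Finset (Fin n) → ℝ
  | 0, ω, a => ∑ i ∈ a, ω i
  | r + 1, ω, a =>
      (∑ i ∈ a, ω i) +
        β * ∑ s : {i // i ∈ a} → Bool,
          obsProb ω a s * Vval n k hk p01 p11 β r (nextState p01 p11 ω a s)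

/-- Replace the coordinates in positions `j` and `j+1` (`0`-indexed) by `x` and `y`. -/
def upd2 {n : ℕ} (ω : Fin n → ℝ) (j : ℕ) (hj : j + 1 < n) (x y : ℝ) : Fin n → ℝ :=
  Function.update (Function.update ω ⟨j, by omega⟩ x) ⟨j + 1, hj⟩ y

/-- The cyclic shift `(ω_2, …, ω_n, ω_1)`. -/
def cyc {n : ℕ} (hn : 0 < n) (ω : Fin n → ℝ) : Fin n → ℝ :=
  fun j => ω ⟨(j.val + 1) % n, Nat.mod_lt _ hn⟩

end

/-- Expectation of `g` applied to the number of successes among independent Bernoulli trials with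
success probabilities listed in the second argument. -/
def bernoulliExp : (ℕ → ℝ) → List ℝ → ℝ
  | g, [] => g 0
  | g, u :: R => u * bernoulliExp (fun m => g (m + 1)) R + (1 - u) * bernoulliExp g R

lemma bernoulliExp_perm {R R' : List ℝ} (h : R.Perm R') :
    ∀ g, bernoulliExp g R = bernoulliExp g R' := by
  induction h with
  | nil => intro g; rfl
  | cons u _ ih => intro g; simp only [bernoulliExp, ih]
  | swap u v R => intro g; simp only [bernoulliExp]; ring
  | trans _ _ ih₁ ih₂ => intro g; rw [ih₁, ih₂]

lemma bernoulliExp_zero (R : List ℝ) : bernoulliExp (fun _ => 0) R = 0 := by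
  induction R with
  | nil => rfl
  | cons u R ih => simp [bernoulliExp, ih]

lemma bernoulliExp_congr (R : List ℝ) :
    ∀ g g' : ℕ → ℝ, (∀ m ≤ R.length, g m = g' m) → bernoulliExp g R = bernoulliExp g' R := by
  induction R with
  | nil => intro g g' h; exact h 0 le_rfl
  | cons u R ih =>
    intro g g' h
    simp only [List.length_cons] at h
    simp only [bernoulliExp]
    rw [ih _ _ fun m hm => h (m + 1) (by omega), ih _ _ fun m hm => h m (by omega)]

lemma bernoulliExp_linear (R : List ℝ) (a b : ℝ) :
    ∀ g g' : ℕ → ℝ, bernoulliExp (fun m => a * g m + b * g' m) R =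
      a * bernoulliExp g R + b * bernoulliExp g' R := by
  induction R with
  | nil => intro g g'; rfl
  | cons u R ih => intro g g'; simp only [bernoulliExp, ih]; ring

lemma bernoulliExp_le (c : ℝ) (R : List ℝ) (hR : ∀ w ∈ R, w ∈ Set.Icc (0 : ℝ) 1) :
    ∀ g g' : ℕ → ℝ, (∀ m ≤ R.length, g m ≤ c + g' m) →
      bernoulliExp g R ≤ c + bernoulliExp g' R := by
  induction R with
  | nil => intro g g' h; exact h 0 le_rfl
  | cons u R ih =>
    intro g g' h
    simp only [List.length_cons] at h
    have hu := hR u (by simp)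
    have hR' : ∀ w ∈ R, w ∈ Set.Icc (0 : ℝ) 1 := fun w hw => hR w (by simp [hw])
    have h₁ := ih hR' _ _ fun m hm => h (m + 1) (by omega)
    have h₀ := ih hR' _ _ fun m hm => h m (by omega)
    have h₁' := mul_le_mul_of_nonneg_left h₁ hu.1
    have h₀' := mul_le_mul_of_nonneg_left h₀ (sub_nonneg.2 hu.2)
    simp only [bernoulliExp]
    linarith

/-- The list form of the information state `vl` reached when the unobserved channels have
beliefs `B` and `m` of the `k` observed channels are good. -/
def nextList (k : ℕ) (p q : ℝ) (B : List ℝ) (m : ℕ) : List ℝ :=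
  List.replicate (k - m) p ++ (B.map (tauF p q) ++ List.replicate m q)

/-- The greedy one-step Bellman operator on functions of belief lists. -/
def greedyStep (k : ℕ) (p q β : ℝ) (f : List ℝ → ℝ) (L : List ℝ) : ℝ :=
  (L.drop (L.length - k)).sum +
    β * bernoulliExp (fun m => f (nextList k p q (L.take (L.length - k)) m))
      (L.drop (L.length - k))

lemma greedyStep_append {k : ℕ} (p q β : ℝ) (f : List ℝ → ℝ) (B R : List ℝ)
    (hR : R.length = k) :
    greedyStep k p q β f (B ++ R) =
      R.sum + β * bernoulliExp (fun m => f (nextList k p q B m)) R := by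
  have h : (B ++ R).length - k = B.length := by simp [hR]
  simp only [greedyStep, h, List.drop_left, List.take_left]

/-- Properties of functions of belief lists of length `N` preserved by `greedyStep`. -/
structure GreedyInvariant (N : ℕ) (f : List ℝ → ℝ) : Prop where
  affine : ∀ A C : List ℝ, ∀ a b w : ℝ, A.length + C.length + 1 = N →
    f (A ++ (w * a + (1 - w) * b) :: C) = w * f (A ++ a :: C) + (1 - w) * f (A ++ b :: C)
  swap : ∀ A C : List ℝ, ∀ x y : ℝ, A.length + C.length + 2 = N →
    (∀ w ∈ A ++ x :: y :: C, w ∈ Set.Icc (0 : ℝ) 1) → y ≤ x →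
    f (A ++ x :: y :: C) ≤ f (A ++ y :: x :: C)
  rotate : ∀ L : List ℝ, ∀ z : ℝ, L.length + 1 = N →
    (∀ w ∈ z :: L, w ∈ Set.Icc (0 : ℝ) 1) → f (z :: L) ≤ 1 + f (L ++ [z])

namespace GreedyInvariant

variable {N : ℕ} {f : List ℝ → ℝ}

lemma move_min (hf : GreedyInvariant N f) (z : ℝ) (L : List ℝ) :
    ∀ A C : List ℝ, A.length + L.length + C.length + 1 = N →
    (∀ w ∈ A ++ (L ++ z :: C), w ∈ Set.Icc (0 : ℝ) 1) → (∀ w ∈ L, z ≤ w) →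
    f (A ++ (L ++ z :: C)) ≤ f (A ++ z :: (L ++ C)) := by
  induction L with
  | nil => intro A C _ _ _; exact le_rfl
  | cons v L ih =>
    intro A C hN h hz
    simp only [List.length_cons] at hN
    have h₁ := ih (A ++ [v]) C (by simp; omega) (by simpa using h)
      (fun w hw => hz w (by simp [hw]))
    have h₂ := hf.swap A (L ++ C) v z (by simp; omega)
      (by intro w hw; apply h; simp at hw ⊢; tauto) (hz v (by simp))
    simp only [List.append_assoc, List.cons_append, List.nil_append] at h₁ ⊢
    exact h₁.trans h₂

lemma move_max (hf : GreedyInvariant N f) (z : ℝ) (L : List ℝ) :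
    ∀ A C : List ℝ, A.length + L.length + C.length + 1 = N →
    (∀ w ∈ A ++ (L ++ z :: C), w ∈ Set.Icc (0 : ℝ) 1) → (∀ w ∈ L, w ≤ z) →
    f (A ++ z :: (L ++ C)) ≤ f (A ++ (L ++ z :: C)) := by
  induction L with
  | nil => intro A C _ _ _; exact le_rfl
  | cons v L ih =>
    intro A C hN h hz
    simp only [List.length_cons] at hN
    have h₁ := ih (A ++ [v]) C (by simp; omega) (by simpa using h)
      (fun w hw => hz w (by simp [hw]))
    have h₂ := hf.swap A (L ++ C) z v (by simp; omega)
      (by intro w hw; apply h; simp at hw ⊢; tauto) (hz v (by simp))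
    simp only [List.append_assoc, List.cons_append, List.nil_append] at h₁ ⊢
    exact h₂.trans h₁

lemma move_replicate_min (hf : GreedyInvariant N f) (p : ℝ) (a : ℕ) (B C : List ℝ)
    (hN : a + B.length + C.length + 1 = N) (hp : p ∈ Set.Icc (0 : ℝ) 1)
    (hB : ∀ w ∈ B, w ∈ Set.Icc p 1) (hC : ∀ w ∈ C, w ∈ Set.Icc p 1) :
    f (List.replicate (a + 1) p ++ (B ++ C)) ≤ 1 + f (List.replicate a p ++ (B ++ p :: C)) := by
  have hB' : ∀ w ∈ B, w ∈ Set.Icc (0 : ℝ) 1 := fun w hw => ⟨hp.1.trans (hB w hw).1, (hB w hw).2⟩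
  have hC' : ∀ w ∈ C, w ∈ Set.Icc (0 : ℝ) 1 := fun w hw => ⟨hp.1.trans (hC w hw).1, (hC w hw).2⟩
  have h₁ := hf.rotate (List.replicate a p ++ (B ++ C)) p (by simp; omega) (by
    intro w hw
    simp only [List.mem_cons, List.mem_append, List.mem_replicate] at hw
    rcases hw with rfl | ⟨_, rfl⟩ | hw | hw
    exacts [hp, hp, hB' _ hw, hC' _ hw])
  have h₂ := hf.move_min p C (List.replicate a p ++ B) [] (by simp; omega) (by
    intro w hw
    simp only [List.mem_cons, List.mem_append, List.mem_replicate, List.not_mem_nil,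
      or_false] at hw
    rcases hw with (⟨_, rfl⟩ | hw) | hw | rfl
    exacts [hp, hB' _ hw, hC' _ hw, hp]) (fun w hw => (hC w hw).1)
  simp only [List.append_assoc, List.append_nil] at h₁ h₂
  rw [List.replicate_succ, List.cons_append]
  linarith

end GreedyInvariant

lemma tauF_mem {p q w : ℝ} (hpq : p ≤ q) (hw : w ∈ Set.Icc (0 : ℝ) 1) :
    tauF p q w ∈ Set.Icc p q := by
  simp only [tauF, Set.mem_Icc]
  constructor <;> nlinarith [hw.1, hw.2]

lemma map_tauF_mem {p q : ℝ} (hpq : p ≤ q) {B : List ℝ} (hB : ∀ w ∈ B, w ∈ Set.Icc (0 : ℝ) 1) :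
    ∀ w ∈ B.map (tauF p q), w ∈ Set.Icc p q := by
  intro w hw
  obtain ⟨v, hv, rfl⟩ := List.mem_map.1 hw
  exact tauF_mem hpq (hB v hv)

section Step

variable {N k : ℕ} {p q β : ℝ} {f : List ℝ → ℝ}

lemma greedyStep_perm (B : List ℝ) {R R' : List ℝ} (hR : R.length = k) (h : R.Perm R') :
    greedyStep k p q β f (B ++ R) = greedyStep k p q β f (B ++ R') := by
  rw [greedyStep_append _ _ _ _ _ _ hR, greedyStep_append _ _ _ _ _ _ (h.length_eq ▸ hR),
    h.sum_eq, bernoulliExp_perm h]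

lemma exists_append_length_right (L : List ℝ) (k : ℕ) (h : k ≤ L.length) :
    ∃ B R, L = B ++ R ∧ R.length = k :=
  ⟨L.take (L.length - k), L.drop (L.length - k), (List.take_append_drop _ _).symm, by
    simp; omega⟩

lemma nextList_affine (hf : GreedyInvariant N f) (A C : List ℝ) (a b w : ℝ)
    (hN : A.length + C.length + 1 + k = N) {m : ℕ} (hm : m ≤ k) :
    f (nextList k p q (A ++ (w * a + (1 - w) * b) :: C) m) =
      w * f (nextList k p q (A ++ a :: C) m) + (1 - w) * f (nextList k p q (A ++ b :: C) m) := by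
  have := hf.affine (List.replicate (k - m) p ++ A.map (tauF p q))
    (C.map (tauF p q) ++ List.replicate m q) (tauF p q a) (tauF p q b) w (by simp; omega)
  have e : tauF p q (w * a + (1 - w) * b) = w * tauF p q a + (1 - w) * tauF p q b := by
    simp only [tauF]; ring
  simpa [nextList, e] using this

lemma greedyStep_affine (hf : GreedyInvariant N f) (hkN : k ≤ N) (A C : List ℝ) (a b w : ℝ)
    (hN : A.length + C.length + 1 = N) :
    greedyStep k p q β f (A ++ (w * a + (1 - w) * b) :: C) =
      w * greedyStep k p q β f (A ++ a :: C) + (1 - w) * greedyStep k p q β f (A ++ b :: C) := by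
  rcases le_or_gt k C.length with hC | hC
  · obtain ⟨C, R, rfl, hR⟩ := exists_append_length_right C k hC
    simp only [List.length_append] at hN
    have e : ∀ v, A ++ v :: (C ++ R) = (A ++ v :: C) ++ R := by simp
    simp only [e, greedyStep_append _ _ _ _ _ _ hR]
    rw [bernoulliExp_congr R _ _ fun m hm => nextList_affine hf A C a b w (by omega)
      (by omega), bernoulliExp_linear]
    ring
  · obtain ⟨B, A, rfl, hA⟩ := exists_append_length_right A (k - 1 - C.length) (by omega)
    have e : ∀ v, greedyStep k p q β f (B ++ A ++ v :: C) =
        (v :: (A ++ C)).sum + β * bernoulliExp (fun m => f (nextList k p q B m))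
          (v :: (A ++ C)) := by
      intro v
      rw [List.append_assoc, greedyStep_perm B (by simp; omega) List.perm_middle,
        greedyStep_append _ _ _ _ _ _ (by simp; omega)]
    simp only [e, bernoulliExp, List.sum_cons]
    ring

lemma nextList_eq_right (k m : ℕ) (p q : ℝ) (A : List ℝ) (x : ℝ) :
    nextList k p q (A ++ [x]) m =
      List.replicate (k - m) p ++ (A.map (tauF p q) ++ tauF p q x :: List.replicate m q) := by
  simp [nextList]

lemma tauF_one (p q : ℝ) : tauF p q 1 = q := by simp [tauF]

lemma tauF_zero (p q : ℝ) : tauF p q 0 = p := by simp [tauF]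

lemma bernoulliExp_nextList_affine (hf : GreedyInvariant N f) (A C R : List ℝ)
    (i : ℕ) (w : ℝ) (hN : A.length + C.length + 1 + k = N) (hR : R.length + i ≤ k) :
    bernoulliExp (fun m => f (nextList k p q (A ++ w :: C) (m + i))) R =
      w * bernoulliExp (fun m => f (nextList k p q (A ++ 1 :: C) (m + i))) R +
      (1 - w) * bernoulliExp (fun m => f (nextList k p q (A ++ 0 :: C) (m + i))) R := by
  rw [← bernoulliExp_linear]
  refine bernoulliExp_congr _ _ _ fun m hm => ?_
  rw [← nextList_affine hf A C 1 0 w hN (by omega)]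
  congr 4
  simp

lemma greedyStep_swap_boundary (hf : GreedyInvariant N f)
    (hp : 0 ≤ p) (hq : q ≤ 1) (hpq : p ≤ q) (hβ : β ∈ Set.Icc (0 : ℝ) 1)
    (A C : List ℝ) (x y : ℝ) (hN : A.length + C.length + 2 = N) (hC : C.length + 1 = k)
    (h : ∀ w ∈ A ++ x :: y :: C, w ∈ Set.Icc (0 : ℝ) 1) (hxy : y ≤ x) :
    greedyStep k p q β f (A ++ x :: y :: C) ≤ greedyStep k p q β f (A ++ y :: x :: C) := by
  have e : ∀ u v, A ++ u :: v :: C = (A ++ [u]) ++ (v :: C) := by simp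
  rw [e, e, greedyStep_append _ _ _ _ _ _ (by simpa using hC),
    greedyStep_append _ _ _ _ _ _ (by simpa using hC)]
  have key := bernoulliExp_le 1 C (fun w hw => h w (by simp [hw]))
    (fun m => f (nextList k p q (A ++ [1]) m))
    (fun m => f (nextList k p q (A ++ [0]) (m + 1))) (by
      intro m hm
      rw [nextList_eq_right, nextList_eq_right, tauF_one, tauF_zero,
        show k - m = k - (m + 1) + 1 by omega]
      refine hf.move_replicate_min p _ _ (q :: List.replicate m q) (by simp; omega)
        ⟨hp, hpq.trans hq⟩ ?_ ?_
      · intro w hw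
        have := map_tauF_mem hpq (fun w hw => h w (by simp [hw])) w hw
        exact ⟨this.1, this.2.trans hq⟩
      · intro w hw
        rw [← List.replicate_succ] at hw
        rw [List.eq_of_mem_replicate hw]
        exact ⟨hpq, hq⟩)
  have a₀ : ∀ w, _ := fun w => bernoulliExp_nextList_affine (k := k) (p := p) (q := q) hf A [] C 0 w
    (by simp; omega) (by omega)
  have a₁ : ∀ w, _ := fun w => bernoulliExp_nextList_affine (k := k) (p := p) (q := q) hf A [] C 1 w
    (by simp; omega) (by omega)
  simp only [add_zero] at a₀
  simp only [bernoulliExp, List.sum_cons, a₀ x, a₀ y, a₁ x, a₁ y]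
  set b := bernoulliExp (fun m => f (nextList k p q (A ++ [1]) m)) C
  set c := bernoulliExp (fun m => f (nextList k p q (A ++ [0]) (m + 1))) C
  have h₁ : 0 ≤ 1 + β * (c - b) := by nlinarith [hβ.1, hβ.2]
  have h₂ := mul_nonneg (sub_nonneg.2 hxy) h₁
  linarith

lemma nextList_mem (hp : 0 ≤ p) (hq : q ≤ 1) (hpq : p ≤ q) {B : List ℝ}
    (hB : ∀ w ∈ B, w ∈ Set.Icc (0 : ℝ) 1) (m : ℕ) :
    ∀ w ∈ nextList k p q B m, w ∈ Set.Icc (0 : ℝ) 1 := by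
  intro w hw
  simp only [nextList, List.mem_append, List.mem_replicate] at hw
  rcases hw with ⟨_, rfl⟩ | hw | ⟨_, rfl⟩
  · exact ⟨hp, hpq.trans hq⟩
  · have := map_tauF_mem hpq hB w hw
    exact ⟨hp.trans this.1, this.2.trans hq⟩
  · exact ⟨hp.trans hpq, hq⟩

lemma greedyStep_swap (hf : GreedyInvariant N f) (hkN : k ≤ N)
    (hp : 0 ≤ p) (hq : q ≤ 1) (hpq : p ≤ q) (hβ : β ∈ Set.Icc (0 : ℝ) 1)
    (A C : List ℝ) (x y : ℝ) (hN : A.length + C.length + 2 = N)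
    (h : ∀ w ∈ A ++ x :: y :: C, w ∈ Set.Icc (0 : ℝ) 1) (hxy : y ≤ x) :
    greedyStep k p q β f (A ++ x :: y :: C) ≤ greedyStep k p q β f (A ++ y :: x :: C) := by
  rcases lt_trichotomy (C.length + 1) k with hC | hC | hC
  · obtain ⟨B, A, rfl, hA⟩ := exists_append_length_right A (k - 2 - C.length) (by omega)
    rw [List.append_assoc, List.append_assoc]
    exact (greedyStep_perm B (by simp; omega) ((List.Perm.swap y x C).append_left A)).le
  · exact greedyStep_swap_boundary hf hp hq hpq hβ A C x y hN hC h hxy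
  · obtain ⟨C, R, rfl, hR⟩ := exists_append_length_right C k (by omega)
    simp only [List.length_append] at hN
    have e : ∀ u v, A ++ u :: v :: (C ++ R) = (A ++ u :: v :: C) ++ R := by simp
    simp only [e] at h ⊢
    rw [greedyStep_append _ _ _ _ _ _ hR, greedyStep_append _ _ _ _ _ _ hR]
    have key := bernoulliExp_le 0 R (fun w hw => h w (List.mem_append_right _ hw))
      (fun m => f (nextList k p q (A ++ x :: y :: C) m))
      (fun m => f (nextList k p q (A ++ y :: x :: C) m)) (by
        intro m hm
        have hmem := nextList_mem (k := k) hp hq hpq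
          (fun w hw => h w (List.mem_append_left _ hw)) m
        have hx := h x (by simp)
        have hy := h y (by simp)
        have := hf.swap (List.replicate (k - m) p ++ A.map (tauF p q))
          (C.map (tauF p q) ++ List.replicate m q) (tauF p q x) (tauF p q y)
          (by simp; omega) (by simpa [nextList] using hmem)
          (by simp only [tauF]; nlinarith)
        simpa [nextList] using this)
    have := mul_le_mul_of_nonneg_left key hβ.1
    linarith

lemma greedyStep_rotate (hf : GreedyInvariant N f) (hk : 1 ≤ k) (hkN : k ≤ N)
    (hp : 0 ≤ p) (hq : q ≤ 1) (hpq : p ≤ q) (hβ : β ∈ Set.Icc (0 : ℝ) 1)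
    (L : List ℝ) (z : ℝ) (hN : L.length + 1 = N)
    (h : ∀ w ∈ z :: L, w ∈ Set.Icc (0 : ℝ) 1) :
    greedyStep k p q β f (z :: L) ≤ 1 + greedyStep k p q β f (L ++ [z]) := by
  rcases hkN.eq_or_lt with hkN' | hkN'
  · have := greedyStep_perm (p := p) (q := q) (β := β) (f := f) (k := k) [] (R := z :: L)
      (R' := L ++ [z]) (by simp; omega) (List.perm_append_singleton z L).symm
    simp only [List.nil_append] at this
    linarith
  obtain ⟨M, R, rfl, hR⟩ := exists_append_length_right L k (by omega)
  obtain ⟨u, R, rfl⟩ : ∃ u R', R = u :: R' := List.exists_cons_of_length_pos (by omega)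
  simp only [List.length_append, List.length_cons] at hN hR
  have hz := h z (by simp)
  have hu := h u (by simp)
  have hM : ∀ w ∈ M, w ∈ Set.Icc (0 : ℝ) 1 := fun w hw => h w (by simp [hw])
  have hR' : ∀ w ∈ R, w ∈ Set.Icc (0 : ℝ) 1 := fun w hw => h w (by simp [hw])
  have hM' : ∀ w ∈ M.map (tauF p q), w ∈ Set.Icc p 1 := fun w hw =>
    ⟨(map_tauF_mem hpq hM w hw).1, (map_tauF_mem hpq hM w hw).2.trans hq⟩
  have hI : ∀ {w}, w ∈ Set.Icc p 1 → w ∈ Set.Icc (0 : ℝ) 1 := fun hw => ⟨hp.trans hw.1, hw.2⟩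
  have hpI : p ∈ Set.Icc (0 : ℝ) 1 := ⟨hp, hpq.trans hq⟩
  have hqI : ∀ m, ∀ w ∈ List.replicate m q, w ∈ Set.Icc p 1 := fun m w hw => by
    rw [List.eq_of_mem_replicate hw]; exact ⟨hpq, hq⟩
  have e₁ : z :: (M ++ u :: R) = ([] ++ z :: M) ++ u :: R := by simp
  have e₂ : M ++ u :: R ++ [z] = (M ++ [u]) ++ (R ++ [z]) := by simp
  rw [e₁, e₂, greedyStep_perm _ (by simpa using hR) (List.perm_append_singleton z R),
    greedyStep_append _ _ _ _ _ _ (by simpa using hR),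
    greedyStep_append _ _ _ _ _ _ (by simpa using hR)]
  have a₀ := bernoulliExp_nextList_affine (k := k) (p := p) (q := q) hf [] M R 0 z
    (by simp; omega) (by omega)
  have a₁ := bernoulliExp_nextList_affine (k := k) (p := p) (q := q) hf [] M R 1 z
    (by simp; omega) (by omega)
  have b₀ := bernoulliExp_nextList_affine (k := k) (p := p) (q := q) hf M [] R 0 u
    (by simp; omega) (by omega)
  have b₁ := bernoulliExp_nextList_affine (k := k) (p := p) (q := q) hf M [] R 1 u
    (by simp; omega) (by omega)
  simp only [add_zero] at a₀ b₀
  simp only [bernoulliExp, List.sum_cons, a₀, a₁, b₀, b₁]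
  have c₁₁ := bernoulliExp_le 0 R hR'
    (fun m => f (nextList k p q ([] ++ 1 :: M) (m + 1)))
    (fun m => f (nextList k p q (M ++ [1]) (m + 1))) (by
      intro m hm
      have := hf.move_max q (M.map (tauF p q)) (List.replicate (k - (m + 1)) p)
        (List.replicate (m + 1) q) (by simp; omega) (by
          intro w hw
          simp only [List.mem_append, List.mem_cons, List.mem_replicate] at hw
          rcases hw with ⟨_, rfl⟩ | hw | rfl | ⟨_, rfl⟩
          exacts [hpI, hI (hM' _ hw), hI ⟨hpq, hq⟩, hI ⟨hpq, hq⟩])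
        (fun w hw => (map_tauF_mem hpq hM w hw).2)
      simpa [nextList, tauF_one] using this)
  have c₀₀ := bernoulliExp_le 1 R hR'
    (fun m => f (nextList k p q ([] ++ 0 :: M) m))
    (fun m => f (nextList k p q (M ++ [0]) m)) (by
      intro m hm
      have := hf.move_replicate_min p (k - m) (M.map (tauF p q)) (List.replicate m q)
        (by simp; omega) hpI hM' (hqI m)
      simpa [nextList, tauF_zero, List.replicate_succ'] using this)
  have c₁₀ : bernoulliExp (fun m => f (nextList k p q ([] ++ 0 :: M) (m + 1))) R =
      bernoulliExp (fun m => f (nextList k p q (M ++ [1]) m)) R := by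
    refine bernoulliExp_congr _ _ _ fun m hm => ?_
    congr 1
    rw [nextList_eq_right, show k - m = k - (m + 1) + 1 by omega, List.replicate_succ']
    simp [nextList, tauF_zero, tauF_one, List.replicate_succ]
  have c₀₁ := bernoulliExp_le 1 R hR'
    (fun m => f (nextList k p q ([] ++ 1 :: M) m))
    (fun m => f (nextList k p q (M ++ [0]) (m + 1))) (by
      intro m hm
      have h₁ := hf.move_max q (M.map (tauF p q)) (List.replicate (k - m) p)
        (List.replicate m q) (by simp; omega) (by
          intro w hw
          simp only [List.mem_append, List.mem_cons, List.mem_replicate] at hw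
          rcases hw with ⟨_, rfl⟩ | hw | rfl | ⟨_, rfl⟩
          exacts [hpI, hI (hM' _ hw), hI ⟨hpq, hq⟩, hI ⟨hpq, hq⟩])
        (fun w hw => (map_tauF_mem hpq hM w hw).2)
      have h₂ := hf.move_replicate_min p (k - (m + 1)) (M.map (tauF p q))
        (List.replicate (m + 1) q) (by simp; omega) hpI hM' (hqI _)
      rw [show k - (m + 1) + 1 = k - m by omega, List.replicate_succ] at h₂
      rw [nextList_eq_right, tauF_zero, List.replicate_succ]
      simp only [nextList, List.nil_append, List.map_cons, tauF_one, List.cons_append]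
      exact h₁.trans h₂)
  rw [c₁₀]
  set a₁₁ := bernoulliExp (fun m => f (nextList k p q ([] ++ 1 :: M) (m + 1))) R
  set a₀₀ := bernoulliExp (fun m => f (nextList k p q ([] ++ 0 :: M) m)) R
  set a₀₁ := bernoulliExp (fun m => f (nextList k p q ([] ++ 1 :: M) m)) R
  set d := bernoulliExp (fun m => f (nextList k p q (M ++ [1]) m)) R
  set b₁₁ := bernoulliExp (fun m => f (nextList k p q (M ++ [1]) (m + 1))) R
  set b₀₀ := bernoulliExp (fun m => f (nextList k p q (M ++ [0]) m)) R
  set b₀₁ := bernoulliExp (fun m => f (nextList k p q (M ++ [0]) (m + 1))) R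
  have hu' := sub_nonneg.2 hu.2
  have hz' := sub_nonneg.2 hz.2
  have bound : ∀ a b : ℝ, a ≤ 1 + b → 0 ≤ 1 - β * (a - b) := fun a b hab => by
    nlinarith [hβ.1, hβ.2]
  have t₁₁ := mul_nonneg (mul_nonneg hu.1 hz.1) (bound a₁₁ b₁₁ (by linarith))
  have t₀₀ := mul_nonneg (mul_nonneg hu' hz') (bound a₀₀ b₀₀ c₀₀)
  have t₀₁ := mul_nonneg (mul_nonneg hu' hz.1) (bound a₀₁ b₀₁ c₀₁)
  have t := mul_nonneg hu' hz.1
  linarith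

lemma GreedyInvariant.step (hf : GreedyInvariant N f) (hk : 1 ≤ k) (hkN : k ≤ N)
    (hp : 0 ≤ p) (hq : q ≤ 1) (hpq : p ≤ q) (hβ : β ∈ Set.Icc (0 : ℝ) 1) :
    GreedyInvariant N (greedyStep k p q β f) where
  affine := greedyStep_affine hf hkN
  swap := greedyStep_swap hf hkN hp hq hpq hβ
  rotate := greedyStep_rotate hf hk hkN hp hq hpq hβ

lemma GreedyInvariant.zero : GreedyInvariant N (fun _ => 0) where
  affine := by intros; ring
  swap := by intros; exact le_rfl
  rotate := by intros; norm_num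

lemma GreedyInvariant.iterate (hk : 1 ≤ k) (hkN : k ≤ N)
    (hp : 0 ≤ p) (hq : q ≤ 1) (hpq : p ≤ q) (hβ : β ∈ Set.Icc (0 : ℝ) 1) (r : ℕ) :
    GreedyInvariant N ((greedyStep k p q β)^[r] fun _ => 0) := by
  induction r with
  | zero => exact GreedyInvariant.zero
  | succ r ih =>
    rw [Function.iterate_succ_apply']
    exact ih.step hk hkN hp hq hpq hβ

end Step

lemma countTrue_cons {k : ℕ} (b : Bool) (l : Fin k → Bool) :
    countTrue (Fin.cons b l : Fin (k + 1) → Bool) = countTrue l + if b then 1 else 0 := by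
  simp only [countTrue, Finset.card_filter, Fin.sum_univ_succ, Fin.cons_zero, Fin.cons_succ]
  rw [add_comm]

lemma sum_qProb_mul {k : ℕ} (u : Fin k → ℝ) :
    ∀ g : ℕ → ℝ, ∑ l : Fin k → Bool, qProb u l * g (countTrue l) =
      bernoulliExp g (List.ofFn u) := by
  induction k with
  | zero => intro g; simp [qProb, countTrue, bernoulliExp]
  | succ k ih =>
    intro g
    rw [← (Fin.consEquiv fun _ : Fin (k + 1) => Bool).sum_comp, Fintype.sum_prod_type]
    have e : ∀ (b : Bool) (l : Fin k → Bool), qProb u (Fin.cons b l : Fin (k + 1) → Bool) =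
        (if b then u 0 else 1 - u 0) * qProb (fun i => u i.succ) l := by
      intro b l
      simp [qProb, Fin.prod_univ_succ]
    have c : ∀ (b : Bool) (l : Fin k → Bool),
        Fin.consEquiv (fun _ : Fin (k + 1) => Bool) (b, l) = Fin.cons b l := fun _ _ => rfl
    simp only [c, e, countTrue_cons, Fintype.sum_bool, List.ofFn_succ,
      bernoulliExp, ← ih, Finset.mul_sum]
    simp [mul_assoc]

lemma drop_ofFn_eq_topCoords {n k : ℕ} (hk : k ≤ n) (ω : Fin n → ℝ) :
    (List.ofFn ω).drop (n - k) = List.ofFn (topCoords hk ω) := by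
  apply List.ext_getElem
  · simp; omega
  · intro i h₁ h₂
    simp [topCoords]

lemma ofFn_vl {n k : ℕ} (hk : k ≤ n) (p q : ℝ) (ω : Fin n → ℝ) {m : ℕ} (hm : m ≤ k) :
    List.ofFn (vl k p q ω m) = nextList k p q ((List.ofFn ω).take (n - k)) m := by
  apply List.ext_getElem
  · simp [nextList]; omega
  · intro i h₁ h₂
    simp only [List.length_ofFn] at h₁
    simp only [nextList, vl, List.getElem_ofFn, List.getElem_append, List.length_replicate,
      List.length_map, List.length_take, List.length_ofFn, List.getElem_replicate,
      List.getElem_map, List.getElem_take]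
    split_ifs <;> first | rfl | omega

lemma sum_top_eq {n k : ℕ} (hk : k ≤ n) (ω : Fin n → ℝ) :
    (∑ i : Fin n, if n - k ≤ i.val then ω i else 0) = (List.ofFn (topCoords hk ω)).sum := by
  obtain ⟨d, rfl⟩ := Nat.exists_eq_add_of_le' hk
  rw [Fin.sum_univ_add, List.sum_ofFn]
  have h₁ : ∀ i : Fin d, ¬ (d + k - k ≤ (Fin.castAdd k i).val) := fun i => by simp
  have h₂ : ∀ i : Fin k, d + k - k ≤ (Fin.natAdd d i).val := fun i => by simp
  simp only [h₁, h₂, if_true, if_false, Finset.sum_const_zero, zero_add]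
  refine Finset.sum_congr rfl fun i _ => ?_
  simp only [topCoords]
  congr 1
  ext
  simp

lemma Wval_eq_iterate {n k : ℕ} (hk : k ≤ n) (p q β : ℝ) (r : ℕ) :
    ∀ ω : Fin n → ℝ, Wval n k hk p q β r ω =
      (greedyStep k p q β)^[r + 1] (fun _ => 0) (List.ofFn ω) := by
  induction r with
  | zero =>
    intro ω
    simp only [Wval, Function.iterate_one, zero_add, greedyStep, List.length_ofFn,
      drop_ofFn_eq_topCoords hk, sum_top_eq hk, bernoulliExp_zero, mul_zero, add_zero]
  | succ r ih =>
    intro ω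
    rw [Function.iterate_succ_apply', greedyStep]
    simp only [Wval, List.length_ofFn, drop_ofFn_eq_topCoords hk, sum_top_eq hk, ih]
    rw [sum_qProb_mul _ fun m =>
      (greedyStep k p q β)^[r + 1] (fun _ => 0) (List.ofFn (vl k p q ω m))]
    congr 2
    refine bernoulliExp_congr _ _ _ fun m hm => ?_
    rw [List.length_ofFn] at hm
    rw [ofFn_vl hk p q ω hm]

lemma ofFn_upd2 {n : ℕ} (ω : Fin n → ℝ) (j : ℕ) (hj : j + 1 < n) (x y : ℝ) :
    List.ofFn (upd2 ω j hj x y) =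
      (List.ofFn ω).take j ++ x :: y :: (List.ofFn ω).drop (j + 2) := by
  apply List.ext_getElem
  · simp; omega
  · intro i h₁ h₂
    simp only [List.length_ofFn] at h₁
    simp only [upd2, Function.update_apply, Fin.ext_iff, List.getElem_ofFn, List.getElem_append,
      List.getElem_cons, List.length_take, List.length_ofFn, List.getElem_take,
      List.getElem_drop]
    split_ifs <;> first | rfl | omega | skip
    congr 2
    omega

/-- under `p01 ≤ p11` and `β ∈ [0,1]`, for every `t ∈ {1,…,T}`,
every increasingly ordered `0 ≤ ω_1 ≤ ⋯ ≤ ω_n ≤ 1`, every `j` with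
`0 ≤ j ≤ n-2`, and all `x ≥ y` in `[0,1]`, the adjacent-swap inequality holds:
`W_t(…, y, x, …) ≥ W_t(…, x, y, …)` with the pair in positions `j+1, j+2`. -/
theorem W_adjacent_swap_inequality
    (n k T : ℕ) (hk1 : 1 ≤ k) (hkn : k ≤ n) (hT : 1 ≤ T)
    (p01 p11 β : ℝ)
    (hp01 : p01 ∈ Set.Icc (0:ℝ) 1) (hp11 : p11 ∈ Set.Icc (0:ℝ) 1)
    (hβ : β ∈ Set.Icc (0:ℝ) 1) (hord : p01 ≤ p11)
    (t : ℕ) (ht1 : 1 ≤ t) (ht2 : t ≤ T)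
    (ω : Fin n → ℝ) (hmono : Monotone ω) (hω : ∀ i, ω i ∈ Set.Icc (0:ℝ) 1)
    (j : ℕ) (hj : j + 1 < n)
    (x y : ℝ) (hx : x ∈ Set.Icc (0:ℝ) 1) (hy : y ∈ Set.Icc (0:ℝ) 1)
    (hxy : y ≤ x) :
    Wval n k hkn p01 p11 β (T - t) (upd2 ω j hj y x) ≥
      Wval n k hkn p01 p11 β (T - t) (upd2 ω j hj x y) := by
  rw [ge_iff_le, Wval_eq_iterate, Wval_eq_iterate, ofFn_upd2, ofFn_upd2]
  refine (GreedyInvariant.iterate hk1 hkn hp01.1 hp11.2 hord hβ _).swap _ _ x y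
    (by simp; omega) ?_ hxy
  have h_mem : ∀ w ∈ List.ofFn ω, w ∈ Set.Icc (0 : ℝ) 1 := by
    intro w hw
    obtain ⟨i, rfl⟩ := (List.mem_ofFn' _ _).1 hw
    exact hω i
  intro w hw
  simp only [List.mem_append, List.mem_cons] at hw
  rcases hw with hw | rfl | rfl | hw
  exacts [h_mem _ (List.mem_of_mem_take hw), hx, hy, h_mem _ (List.mem_of_mem_drop hw)]
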